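/- (Lemma 4.1) The coefficients of the third fundamental forms of a patch and of its inverse patch satisfy P̃ = P + 2ξe + ξ²E, Q̃ = Q + 2ξf + ξ²F, and R̃ = R + 2ξg + ξ²G at every point (u,v), where ξ = 2η/‖x − c‖². -/

import Mathlib

noncomputable section
open scoped RealInnerProductSpace

/-- ℝ³ as Euclidean 3-space. -/
abbrev E3 : Type := EuclideanSpace ℝ (Fin 3)

/-- The cross product on ℝ³. -/
def cross (a b : E3) : E3 :=
  (WithLp.equiv 2 (Fin 3 → ℝ)).symm
    ![a 1 * b 2 - a 2 * b 1, a 2 * b 0 - a 0 * b 2, a 0 * b 1 - a 1 * b 0]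

/-- The inversion of ℝ³ with center `c` and radius `r`. -/
def inv3 (c : E3) (r : ℝ) (p : E3) : E3 :=
  c + (r ^ 2 / ‖p - c‖ ^ 2) • (p - c)

/-- Partial derivative in the first variable. -/
def pu {E : Type*} [NormedAddCommGroup E] [NormedSpace ℝ E]
    (x : ℝ → ℝ → E) (u v : ℝ) : E :=
  deriv (fun t => x t v) u

/-- Partial derivative in the second variable. -/
def pv {E : Type*} [NormedAddCommGroup E] [NormedSpace ℝ E]
    (x : ℝ → ℝ → E) (u v : ℝ) : E :=
  deriv (fun t => x u t) v

/-- The unit normal of a patch. -/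
def unormal (x : ℝ → ℝ → E3) (u v : ℝ) : E3 :=
  ‖cross (pu x u v) (pv x u v)‖⁻¹ • cross (pu x u v) (pv x u v)

/-- The conformal factor λ of the inversion along the patch. -/
def lam (c : E3) (r : ℝ) (x : ℝ → ℝ → E3) (u v : ℝ) : ℝ :=
  r ^ 2 / ‖x u v - c‖ ^ 2

/-- The support-type function η = ⟨U_x, x − c⟩. -/
def eta (c : E3) (x : ℝ → ℝ → E3) (u v : ℝ) : ℝ :=
  ⟪unormal x u v, x u v - c⟫

/-- First fundamental form coefficient E. -/
def FFE (x : ℝ → ℝ → E3) (u v : ℝ) : ℝ := ⟪pu x u v, pu x u v⟫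
/-- First fundamental form coefficient F. -/
def FFF (x : ℝ → ℝ → E3) (u v : ℝ) : ℝ := ⟪pu x u v, pv x u v⟫
/-- First fundamental form coefficient G. -/
def FFG (x : ℝ → ℝ → E3) (u v : ℝ) : ℝ := ⟪pv x u v, pv x u v⟫
/-- Second fundamental form coefficient e. -/
def SFe (x : ℝ → ℝ → E3) (u v : ℝ) : ℝ := ⟪pu (pu x) u v, unormal x u v⟫
/-- Second fundamental form coefficient f. -/
def SFf (x : ℝ → ℝ → E3) (u v : ℝ) : ℝ := ⟪pv (pu x) u v, unormal x u v⟫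
/-- Second fundamental form coefficient g. -/
def SFg (x : ℝ → ℝ → E3) (u v : ℝ) : ℝ := ⟪pv (pv x) u v, unormal x u v⟫
/-- Third fundamental form coefficient P. -/
def TFP (x : ℝ → ℝ → E3) (u v : ℝ) : ℝ := ⟪pu (unormal x) u v, pu (unormal x) u v⟫
/-- Third fundamental form coefficient Q. -/
def TFQ (x : ℝ → ℝ → E3) (u v : ℝ) : ℝ := ⟪pu (unormal x) u v, pv (unormal x) u v⟫
/-- Third fundamental form coefficient R. -/
def TFR (x : ℝ → ℝ → E3) (u v : ℝ) : ℝ := ⟪pv (unormal x) u v, pv (unormal x) u v⟫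

/-- Christoffel symbol Γ¹₁₁. -/
def Ch111 (x : ℝ → ℝ → E3) (u v : ℝ) : ℝ :=
  (FFG x u v * pu (FFE x) u v - 2 * FFF x u v * pu (FFF x) u v + FFF x u v * pv (FFE x) u v) /
    (2 * (FFE x u v * FFG x u v - FFF x u v ^ 2))
/-- Christoffel symbol Γ²₁₁. -/
def Ch211 (x : ℝ → ℝ → E3) (u v : ℝ) : ℝ :=
  (2 * FFE x u v * pu (FFF x) u v - FFE x u v * pv (FFE x) u v - FFF x u v * pu (FFE x) u v) /
    (2 * (FFE x u v * FFG x u v - FFF x u v ^ 2))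
/-- Christoffel symbol Γ¹₁₂. -/
def Ch112 (x : ℝ → ℝ → E3) (u v : ℝ) : ℝ :=
  (FFG x u v * pv (FFE x) u v - FFF x u v * pu (FFG x) u v) /
    (2 * (FFE x u v * FFG x u v - FFF x u v ^ 2))
/-- Christoffel symbol Γ²₁₂. -/
def Ch212 (x : ℝ → ℝ → E3) (u v : ℝ) : ℝ :=
  (FFE x u v * pu (FFG x) u v - FFF x u v * pv (FFE x) u v) /
    (2 * (FFE x u v * FFG x u v - FFF x u v ^ 2))
/-- Christoffel symbol Γ¹₂₂. -/
def Ch122 (x : ℝ → ℝ → E3) (u v : ℝ) : ℝ :=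
  (2 * FFG x u v * pv (FFF x) u v - FFG x u v * pu (FFG x) u v - FFF x u v * pv (FFG x) u v) /
    (2 * (FFE x u v * FFG x u v - FFF x u v ^ 2))
/-- Christoffel symbol Γ²₂₂. -/
def Ch222 (x : ℝ → ℝ → E3) (u v : ℝ) : ℝ :=
  (FFE x u v * pv (FFG x) u v - 2 * FFF x u v * pv (FFF x) u v + FFF x u v * pu (FFG x) u v) /
    (2 * (FFE x u v * FFG x u v - FFF x u v ^ 2))

/-- The tangent map of the inversion at `p`. -/
def phiStar (c : E3) (r : ℝ) (p : E3) (w : E3) : E3 :=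
  (r ^ 2 / ‖p - c‖ ^ 2) • w - (2 * r ^ 2 * ⟪p - c, w⟫ / ‖p - c‖ ^ 4) • (p - c)

section PartialDerivatives

variable {E : Type*} [NormedAddCommGroup E] [NormedSpace ℝ E] {x : ℝ → ℝ → E}

theorem hasDerivAt_pu (hx : Differentiable ℝ (fun p : ℝ × ℝ => x p.1 p.2)) (u v : ℝ) :
    HasDerivAt (fun t => x t v) (pu x u v) u := by
  have h : Differentiable ℝ (fun t : ℝ => x t v) :=
    hx.comp (g := fun p : ℝ × ℝ => x p.1 p.2) (f := fun t : ℝ => (t, v)) (by fun_prop)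
  exact (h u).hasDerivAt

theorem hasDerivAt_pv (hx : Differentiable ℝ (fun p : ℝ × ℝ => x p.1 p.2)) (u v : ℝ) :
    HasDerivAt (fun t => x u t) (pv x u v) v := by
  have h : Differentiable ℝ (fun t : ℝ => x u t) :=
    hx.comp (g := fun p : ℝ × ℝ => x p.1 p.2) (f := fun t : ℝ => (u, t)) (by fun_prop)
  exact (h v).hasDerivAt

theorem pu_eq_fderiv (hx : Differentiable ℝ (fun p : ℝ × ℝ => x p.1 p.2)) (u v : ℝ) :
    pu x u v = fderiv ℝ (fun p : ℝ × ℝ => x p.1 p.2) (u, v) (1, 0) :=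
  ((hx (u, v)).hasFDerivAt.comp_hasDerivAt (f := fun t : ℝ => (t, v)) u
    ((hasDerivAt_id u).prodMk (hasDerivAt_const u v))).deriv

theorem pv_eq_fderiv (hx : Differentiable ℝ (fun p : ℝ × ℝ => x p.1 p.2)) (u v : ℝ) :
    pv x u v = fderiv ℝ (fun p : ℝ × ℝ => x p.1 p.2) (u, v) (0, 1) :=
  ((hx (u, v)).hasFDerivAt.comp_hasDerivAt (f := fun t : ℝ => (u, t)) v
    ((hasDerivAt_const v u).prodMk (hasDerivAt_id v))).deriv

theorem contDiff_pu (hx : ContDiff ℝ (⊤ : ℕ∞) (fun p : ℝ × ℝ => x p.1 p.2)) :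
    ContDiff ℝ (⊤ : ℕ∞) (fun p : ℝ × ℝ => pu x p.1 p.2) := by
  simp only [pu_eq_fderiv (hx.differentiable (by simp))]
  exact (hx.fderiv_right (by simp)).clm_apply contDiff_const

theorem contDiff_pv (hx : ContDiff ℝ (⊤ : ℕ∞) (fun p : ℝ × ℝ => x p.1 p.2)) :
    ContDiff ℝ (⊤ : ℕ∞) (fun p : ℝ × ℝ => pv x p.1 p.2) := by
  simp only [pv_eq_fderiv (hx.differentiable (by simp))]
  exact (hx.fderiv_right (by simp)).clm_apply contDiff_const

/-- Mixed partial derivatives of a smooth patch commute. -/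
theorem pu_pv_comm (hx : ContDiff ℝ (⊤ : ℕ∞) (fun p : ℝ × ℝ => x p.1 p.2)) (u v : ℝ) :
    pu (pv x) u v = pv (pu x) u v := by
  have hd : Differentiable ℝ (fun p : ℝ × ℝ => x p.1 p.2) := hx.differentiable (by simp)
  have hdd : Differentiable ℝ (fderiv ℝ (fun p : ℝ × ℝ => x p.1 p.2)) :=
    (hx.fderiv_right (m := (⊤ : ℕ∞)) (by simp)).differentiable (by simp)
  rw [pu_eq_fderiv ((contDiff_pv hx).differentiable (by simp)),
    pv_eq_fderiv ((contDiff_pu hx).differentiable (by simp))]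
  simp only [pu_eq_fderiv hd, pv_eq_fderiv hd]
  rw [fderiv_clm_apply (hdd _) (differentiableAt_const _),
    fderiv_clm_apply (hdd _) (differentiableAt_const _)]
  have hs : IsSymmSndFDerivAt ℝ (fun p : ℝ × ℝ => x p.1 p.2) (u, v) :=
    hx.contDiffAt.isSymmSndFDerivAt
      (by simpa using WithTop.coe_le_coe.2 (le_top (a := (2 : ℕ∞))))
  simpa using hs.eq (1, 0) (0, 1)

end PartialDerivatives

section Cross

theorem inner_cross_left (a b : E3) : ⟪cross a b, a⟫ = 0 := by
  simp [cross, PiLp.inner_apply, Fin.sum_univ_three]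
  ring

theorem inner_cross_right (a b : E3) : ⟪cross a b, b⟫ = 0 := by
  simp [cross, PiLp.inner_apply, Fin.sum_univ_three]
  ring

theorem cross_smul_smul (k : ℝ) (a b : E3) : cross (k • a) (k • b) = k ^ 2 • cross a b := by
  ext i
  fin_cases i <;> simp [cross] <;> ring

/-- A reflection in a plane reverses the orientation of cross products. -/
theorem cross_reflection {w : E3} (hw : w ≠ 0) (a b : E3) :
    cross (a - (2 * ⟪w, a⟫ / ‖w‖ ^ 2) • w) (b - (2 * ⟪w, b⟫ / ‖w‖ ^ 2) • w) =
      -(cross a b - (2 * ⟪w, cross a b⟫ / ‖w‖ ^ 2) • w) := by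
  have hn : ‖w‖ ^ 2 ≠ 0 := by simpa using hw
  rw [EuclideanSpace.real_norm_sq_eq, Fin.sum_univ_three] at *
  ext i
  fin_cases i <;> simp [cross, PiLp.inner_apply, Fin.sum_univ_three] <;> field_simp <;> ring

theorem norm_reflection {w : E3} (hw : w ≠ 0) (a : E3) :
    ‖a - (2 * ⟪w, a⟫ / ‖w‖ ^ 2) • w‖ = ‖a‖ := by
  have hn : ‖w‖ ≠ 0 := by simpa using hw
  rw [← sq_eq_sq₀ (norm_nonneg _) (norm_nonneg _), norm_sub_sq_real, norm_smul, mul_pow,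
    inner_smul_right, real_inner_comm, Real.norm_eq_abs, sq_abs]
  field_simp
  ring

end Cross

section Normal

variable {x : ℝ → ℝ → E3}

theorem contDiff_cross_pu_pv (hx : ContDiff ℝ (⊤ : ℕ∞) (fun p : ℝ × ℝ => x p.1 p.2)) :
    ContDiff ℝ (⊤ : ℕ∞) (fun p : ℝ × ℝ => cross (pu x p.1 p.2) (pv x p.1 p.2)) := by
  have hu := contDiff_euclidean.1 (contDiff_pu hx)
  have hv := contDiff_euclidean.1 (contDiff_pv hx)
  refine contDiff_euclidean.2 fun i => ?_
  fin_cases i <;> simp only [cross, WithLp.equiv_symm_apply] <;>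
    exact ((hu _).mul (hv _)).sub ((hu _).mul (hv _))

theorem differentiable_unormal (hx : ContDiff ℝ (⊤ : ℕ∞) (fun p : ℝ × ℝ => x p.1 p.2))
    (hreg : ∀ u v : ℝ, cross (pu x u v) (pv x u v) ≠ 0) :
    Differentiable ℝ (fun p : ℝ × ℝ => unormal x p.1 p.2) := by
  have hc := (contDiff_cross_pu_pv hx).differentiable (by simp)
  intro p
  exact (((hc p).norm ℝ (hreg _ _)).inv (norm_ne_zero_iff.2 (hreg _ _))).smul (hc p)

theorem inner_unormal_pu (u v : ℝ) : ⟪unormal x u v, pu x u v⟫ = 0 := by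
  rw [unormal, real_inner_smul_left, inner_cross_left, mul_zero]

theorem inner_unormal_pv (u v : ℝ) : ⟪unormal x u v, pv x u v⟫ = 0 := by
  rw [unormal, real_inner_smul_left, inner_cross_right, mul_zero]

end Normal

section Inversion

theorem hasDerivAt_inv3 (c : E3) (r : ℝ) {γ : ℝ → E3} {γ' : E3} {t : ℝ}
    (hγ : HasDerivAt γ γ' t) (hc : γ t ≠ c) :
    HasDerivAt (fun s => inv3 c r (γ s)) (phiStar c r (γ t) γ') t := by
  have hw : HasDerivAt (fun s => γ s - c) γ' t := hγ.sub_const c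
  have hn : ‖γ t - c‖ ≠ 0 := norm_ne_zero_iff.2 (sub_ne_zero.2 hc)
  have h := ((((hasDerivAt_const t (r ^ 2)).div hw.norm_sq (pow_ne_zero 2 hn)).smul hw).const_add c)
  refine h.congr_deriv ?_
  rw [phiStar, sub_eq_add_neg _ ((_ : ℝ) • _), ← neg_smul]
  congr 2
  field_simp
  ring

/-- The tangent map of an inversion is a reflection followed by a homothety. -/
theorem phiStar_eq (c : E3) (r : ℝ) (p w : E3) :
    phiStar c r p w =
      (r ^ 2 / ‖p - c‖ ^ 2) • (w - (2 * ⟪p - c, w⟫ / ‖p - c‖ ^ 2) • (p - c)) := by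
  rw [phiStar, smul_sub _ w, smul_smul]
  congr 2
  ring

variable {c : E3} {r : ℝ} {x y : ℝ → ℝ → E3}

theorem unormal_inverse_patch (hr : 0 < r)
    (hx : Differentiable ℝ (fun p : ℝ × ℝ => x p.1 p.2))
    (hxc : ∀ u v : ℝ, x u v ≠ c) (hy : ∀ u v : ℝ, y u v = inv3 c r (x u v)) (u v : ℝ) :
    unormal y u v =
      -unormal x u v + (2 * eta c x u v / ‖x u v - c‖ ^ 2) • (x u v - c) := by
  obtain rfl : y = fun u v => inv3 c r (x u v) := funext fun u => funext fun v => hy u v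
  have hw : x u v - c ≠ 0 := sub_ne_zero.2 (hxc u v)
  have hn : ‖x u v - c‖ ≠ 0 := norm_ne_zero_iff.2 hw
  have hu : pu (fun u v => inv3 c r (x u v)) u v = phiStar c r (x u v) (pu x u v) :=
    (hasDerivAt_inv3 c r (hasDerivAt_pu hx u v) (hxc u v)).deriv
  have hv : pv (fun u v => inv3 c r (x u v)) u v = phiStar c r (x u v) (pv x u v) :=
    (hasDerivAt_inv3 c r (hasDerivAt_pv hx u v) (hxc u v)).deriv
  have hk : 0 < (r ^ 2 / ‖x u v - c‖ ^ 2) ^ 2 := by positivity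
  simp only [eta, unormal]
  rw [hu, hv, phiStar_eq, phiStar_eq, cross_smul_smul, cross_reflection hw, norm_smul, norm_neg,
    norm_reflection hw, smul_smul, Real.norm_of_nonneg hk.le, mul_inv_rev, mul_assoc,
    inv_mul_cancel₀ hk.ne', mul_one, smul_neg, smul_sub, smul_smul, neg_sub, sub_eq_neg_add,
    real_inner_smul_left, real_inner_comm]
  congr 2
  ring

end Inversion

section Curves

variable {V : Type*} [NormedAddCommGroup V] [InnerProductSpace ℝ V]

theorem inner_deriv_of_inner_eq_zero {N T : ℝ → V} {N' T' : V} {t : ℝ}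
    (hN : HasDerivAt N N' t) (hT : HasDerivAt T T' t) (h : ∀ s, ⟪N s, T s⟫ = 0) :
    ⟪N', T t⟫ = -⟪T', N t⟫ := by
  have h₁ := hN.inner ℝ hT
  simp only [h] at h₁
  have h₂ := h₁.unique (hasDerivAt_const t 0)
  rw [real_inner_comm T' (N t)] at *
  linarith

/-- The derivative of the reflected normal `-N + ξ w`, where `ξ = 2⟪N, w⟫ / ‖w‖²`, together with
the relation obtained by differentiating `ξ ‖w‖² = 2⟪N, w⟫`. -/
theorem exists_hasDerivAt_reflected_normal {N w : ℝ → V} {N' w' : V} {t : ℝ}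
    (hN : HasDerivAt N N' t) (hw : HasDerivAt w w' t) (h₀ : w t ≠ 0) (h : ⟪N t, w'⟫ = 0) :
    ∃ d : ℝ,
      HasDerivAt (fun s => -N s + (2 * ⟪N s, w s⟫ / ‖w s‖ ^ 2) • w s)
        (-N' + ((2 * ⟪N t, w t⟫ / ‖w t‖ ^ 2) • w' + d • w t)) t ∧
      d * ‖w t‖ ^ 2 = 2 * ⟪N', w t⟫ - 2 * (2 * ⟪N t, w t⟫ / ‖w t‖ ^ 2) * ⟪w t, w'⟫ := by
  have hn : ‖w t‖ ≠ 0 := norm_ne_zero_iff.2 h₀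
  have hd := ((hN.inner ℝ hw).const_mul 2).div hw.norm_sq (pow_ne_zero 2 hn)
  refine ⟨_, hN.neg.add (hd.smul hw), ?_⟩
  rw [h]
  field_simp
  ring

theorem inner_reflected_normal_derivs {N₁ N₂ w w₁ w₂ : V} {ξ d₁ d₂ f : ℝ}
    (h₁ : d₁ * ‖w‖ ^ 2 = 2 * ⟪N₁, w⟫ - 2 * ξ * ⟪w, w₁⟫)
    (h₂ : d₂ * ‖w‖ ^ 2 = 2 * ⟪N₂, w⟫ - 2 * ξ * ⟪w, w₂⟫)
    (hf₁ : ⟪N₁, w₂⟫ = -f) (hf₂ : ⟪N₂, w₁⟫ = -f) :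
    ⟪-N₁ + (ξ • w₁ + d₁ • w), -N₂ + (ξ • w₂ + d₂ • w)⟫ =
      ⟪N₁, N₂⟫ + 2 * ξ * f + ξ ^ 2 * ⟪w₁, w₂⟫ := by
  simp only [inner_add_left, inner_add_right, inner_neg_left, inner_neg_right,
    real_inner_smul_left, real_inner_smul_right, real_inner_self_eq_norm_sq]
  rw [real_inner_comm N₂ w₁, real_inner_comm N₂ w, real_inner_comm w w₁, hf₁, hf₂]
  linear_combination (d₂ / 2) * h₁ + (d₁ / 2) * h₂

end Curves

theorem inverse_patch_third_fundamental_form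
    (c : E3) (r : ℝ) (hr : 0 < r)
    (x : ℝ → ℝ → E3)
    (hx : ContDiff ℝ (⊤ : ℕ∞) (fun p : ℝ × ℝ => x p.1 p.2))
    (hxc : ∀ u v : ℝ, x u v ≠ c)
    (y : ℝ → ℝ → E3) (hy : ∀ u v : ℝ, y u v = inv3 c r (x u v))
    (hreg : ∀ u v : ℝ, cross (pu x u v) (pv x u v) ≠ 0) :
    ∀ u v : ℝ,
      TFP y u v = TFP x u v + 2 * (2 * eta c x u v / ‖x u v - c‖ ^ 2) * SFe x u v +
          (2 * eta c x u v / ‖x u v - c‖ ^ 2) ^ 2 * FFE x u v ∧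
      TFQ y u v = TFQ x u v + 2 * (2 * eta c x u v / ‖x u v - c‖ ^ 2) * SFf x u v +
          (2 * eta c x u v / ‖x u v - c‖ ^ 2) ^ 2 * FFF x u v ∧
      TFR y u v = TFR x u v + 2 * (2 * eta c x u v / ‖x u v - c‖ ^ 2) * SFg x u v +
          (2 * eta c x u v / ‖x u v - c‖ ^ 2) ^ 2 * FFG x u v := by
  intro u v
  have hd : Differentiable ℝ (fun p : ℝ × ℝ => x p.1 p.2) := hx.differentiable (by simp)
  have hN := differentiable_unormal hx hreg
  have hxu := (contDiff_pu hx).differentiable (by simp)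
  have hxv := (contDiff_pv hx).differentiable (by simp)
  have hUy := unormal_inverse_patch hr hd hxc hy
  have hw : x u v - c ≠ 0 := sub_ne_zero.2 (hxc u v)
  obtain ⟨d₁, hd₁, h₁⟩ := exists_hasDerivAt_reflected_normal (hasDerivAt_pu hN u v)
    ((hasDerivAt_pu hd u v).sub_const c) hw (inner_unormal_pu u v)
  obtain ⟨d₂, hd₂, h₂⟩ := exists_hasDerivAt_reflected_normal (hasDerivAt_pv hN u v)
    ((hasDerivAt_pv hd u v).sub_const c) hw (inner_unormal_pv u v)
  have hyu : pu (unormal y) u v = _ :=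
    (hd₁.congr_of_eventuallyEq (.of_forall fun t => hUy t v)).deriv
  have hyv : pv (unormal y) u v = _ :=
    (hd₂.congr_of_eventuallyEq (.of_forall fun t => hUy u t)).deriv
  have he : ⟪pu (unormal x) u v, pu x u v⟫ = -SFe x u v :=
    inner_deriv_of_inner_eq_zero (N := fun t => unormal x t v) (T := fun t => pu x t v)
      (hasDerivAt_pu hN u v) (hasDerivAt_pu hxu u v)
      fun t => inner_unormal_pu t v
  have hf : ⟪pv (unormal x) u v, pu x u v⟫ = -SFf x u v :=
    inner_deriv_of_inner_eq_zero (N := fun t => unormal x u t) (T := fun t => pu x u t)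
      (hasDerivAt_pv hN u v) (hasDerivAt_pv hxu u v)
      fun t => inner_unormal_pu u t
  have hf' : ⟪pu (unormal x) u v, pv x u v⟫ = -SFf x u v := by
    rw [SFf, ← pu_pv_comm hx]
    exact inner_deriv_of_inner_eq_zero (N := fun t => unormal x t v) (T := fun t => pv x t v)
      (hasDerivAt_pu hN u v) (hasDerivAt_pu hxv u v)
      fun t => inner_unormal_pv t v
  have hg : ⟪pv (unormal x) u v, pv x u v⟫ = -SFg x u v :=
    inner_deriv_of_inner_eq_zero (N := fun t => unormal x u t) (T := fun t => pv x u t)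
      (hasDerivAt_pv hN u v) (hasDerivAt_pv hxv u v)
      fun t => inner_unormal_pv u t
  rw [TFP, TFQ, TFR, hyu, hyv]
  exact ⟨inner_reflected_normal_derivs h₁ h₁ he he, inner_reflected_normal_derivs h₁ h₂ hf' hf,
    inner_reflected_normal_derivs h₂ h₂ hg hg⟩
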